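/- arXiv:1611.01940 — 2 statements merged into one kernel-verified Lean document; each statement's English description precedes it below -/
import Mathlib

section
/- Determinant of the m-th symmetric power. Let K be a field, n ≥ 1, A ∈ Matrix (Fin n) (Fin n) K, and m ∈ ℕ. Let I_m := {μ ∈ ℕⁿ : |μ| = m} and define the matrix C, indexed by I_m × I_m, by letting C_{λ,μ} ∈ K be the coefficient of the monomial X^λ = X₁^{λ₁}⋯Xₙ^{λₙ} in the polynomial ∏_{j=1}^n (Σ_{l=1}^n A_{j,l}·X_l)^{μⱼ} ∈ K[X₁,…,Xₙ]. Then det C = (det A)^{B(n,m)}, where B(n,m) := binom(n+m−1, n). (C is the matrix of the m-th symmetric power of the endomorphism with matrix Aᵀ, acting on the monomial basis of homogeneous polynomials of degree m; so this states that the determinant of the m-th symmetric power of an endomorphism φ of an n-dimensional vector space equals det(φ)^{binom(n+m−1,n)}.) -/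
open Finset MvPolynomial in
/-- The matrix of the `m`-th symmetric power of `Aᵀ` in the basis of monomials of degree `m`. -/
noncomputable def symPowMatrix {R : Type*} [CommSemiring R] {n : ℕ} (m : ℕ)
    (A : Matrix (Fin n) (Fin n) R) :
    Matrix {x : Fin n → ℕ // x ∈ Finset.Nat.antidiagonalTuple n m}
      {x : Fin n → ℕ // x ∈ Finset.Nat.antidiagonalTuple n m} R :=
  Matrix.of fun lam μ =>
    coeff (Finsupp.equivFunOnFinite.symm lam.1) (∏ j, (∑ l, C (A j l) * X l) ^ (μ.1 j))

namespace symPowMatrix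

open Finset MvPolynomial

section Multiplicativity

variable {R : Type*} [CommSemiring R] {n m : ℕ}

theorem apply (A : Matrix (Fin n) (Fin n) R)
    (lam μ : {x : Fin n → ℕ // x ∈ Finset.Nat.antidiagonalTuple n m}) :
    symPowMatrix m A lam μ =
      coeff (Finsupp.equivFunOnFinite.symm lam.1) (∏ j, (∑ l, C (A j l) * X l) ^ (μ.1 j)) :=
  rfl

theorem isHomogeneous_prod_linearForm_pow (A : Matrix (Fin n) (Fin n) R)
    {μ : Fin n → ℕ} (hμ : μ ∈ Finset.Nat.antidiagonalTuple n m) :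
    (∏ j, (∑ l, C (A j l) * X l : MvPolynomial (Fin n) R) ^ μ j).IsHomogeneous m := by
  rw [← Finset.Nat.mem_antidiagonalTuple.mp hμ]
  refine IsHomogeneous.prod _ _ _ fun j _ => ?_
  simpa using (IsHomogeneous.sum univ _ 1 fun l _ => isHomogeneous_C_mul_X (A j l) l).pow (μ j)

theorem sum_antidiagonalTuple_monomial_coeff {p : MvPolynomial (Fin n) R}
    (hp : p.IsHomogeneous m) :
    p = ∑ ν : {x : Fin n → ℕ // x ∈ Finset.Nat.antidiagonalTuple n m},
      C (coeff (Finsupp.equivFunOnFinite.symm ν.1) p) * ∏ j, X j ^ ν.1 j := by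
  classical
  have hmon (ν : Fin n → ℕ) (c : R) :
      C c * ∏ j, X j ^ ν j = monomial (Finsupp.equivFunOnFinite.symm ν) c := by
    rw [monomial_eq, Finsupp.prod_fintype _ _ (by simp)]
    simp
  ext d
  simp_rw [hmon, coeff_sum, coeff_monomial]
  by_cases hd : ∑ i, d i = m
  · rw [Finset.sum_eq_single ⟨d, Finset.Nat.mem_antidiagonalTuple.mpr hd⟩]
    · simp
    · rintro ν - hν
      exact if_neg fun h => hν (Subtype.ext (congrArg DFunLike.coe h))
    · simp
  · rw [hp.coeff_eq_zero (by rwa [Finsupp.degree_eq_sum]), Finset.sum_eq_zero]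
    rintro ν -
    refine if_neg fun h => hd ?_
    rw [← h]
    exact Finset.Nat.mem_antidiagonalTuple.mp ν.2

protected theorem mul (A B : Matrix (Fin n) (Fin n) R) :
    symPowMatrix m (A * B) = symPowMatrix m B * symPowMatrix m A := by
  ext lam μ
  have hcomp : (∏ j, (∑ l, C ((A * B) j l) * X l : MvPolynomial (Fin n) R) ^ μ.1 j) =
      aeval (fun j => ∑ l, C (B j l) * X l : Fin n → MvPolynomial (Fin n) R)
        (∏ j, (∑ l, C (A j l) * X l) ^ μ.1 j) := by
    simp only [map_prod, map_pow, map_sum, map_mul, aeval_X, algHom_C, algebraMap_eq,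
      Matrix.mul_apply, Finset.mul_sum, Finset.sum_mul]
    refine Finset.prod_congr rfl fun j _ => congrArg (· ^ μ.1 j) ?_
    rw [Finset.sum_comm]
    simp only [mul_assoc]
  rw [apply, hcomp,
    sum_antidiagonalTuple_monomial_coeff (isHomogeneous_prod_linearForm_pow A μ.2),
    map_sum, coeff_sum, Matrix.mul_apply]
  refine Finset.sum_congr rfl fun ν _ => ?_
  simp only [map_prod, map_pow, map_mul, aeval_X, algHom_C, algebraMap_eq, coeff_C_mul, apply]
  exact mul_comm _ _

end Multiplicativity

theorem card_antidiagonalTuple (n m : ℕ) :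
    #(Finset.Nat.antidiagonalTuple n m) = (n + m - 1).choose m := by
  rw [← Finset.piAntidiag_univ_fin_eq_antidiagonalTuple, ← Finset.map_sym_eq_piAntidiag,
    Finset.card_map, Finset.sym_univ, Finset.card_univ, Sym.card_sym_eq_choose, Fintype.card_fin]

theorem sum_antidiagonalTuple_apply {n : ℕ} (m : ℕ) (i : Fin n) :
    ∑ μ ∈ Finset.Nat.antidiagonalTuple n m, μ i = (n + m - 1).choose n := by
  have hsymm (j : Fin n) : ∑ μ ∈ Finset.Nat.antidiagonalTuple n m, μ j =
      ∑ μ ∈ Finset.Nat.antidiagonalTuple n m, μ i := by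
    have hmem (μ : Fin n → ℕ) (hμ : μ ∈ Finset.Nat.antidiagonalTuple n m) :
        μ ∘ Equiv.swap i j ∈ Finset.Nat.antidiagonalTuple n m := by
      rw [Finset.Nat.mem_antidiagonalTuple] at hμ ⊢
      rw [← hμ]
      exact Equiv.sum_comp (Equiv.swap i j) μ
    refine Finset.sum_bij' (fun μ _ => μ ∘ Equiv.swap i j) (fun μ _ => μ ∘ Equiv.swap i j)
      hmem hmem ?_ ?_ ?_
    · intro μ _
      ext k
      simp
    · intro μ _
      ext k
      simp
    · intro μ _
      simp
  have htotal : n * ∑ μ ∈ Finset.Nat.antidiagonalTuple n m, μ i =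
      m * (n + m - 1).choose m := by
    calc n * ∑ μ ∈ Finset.Nat.antidiagonalTuple n m, μ i
        = ∑ j, ∑ μ ∈ Finset.Nat.antidiagonalTuple n m, μ j := by simp [hsymm]
      _ = ∑ μ ∈ Finset.Nat.antidiagonalTuple n m, m := by
        rw [Finset.sum_comm]
        exact Finset.sum_congr rfl fun μ hμ => Finset.Nat.mem_antidiagonalTuple.mp hμ
      _ = m * (n + m - 1).choose m := by
        rw [Finset.sum_const, card_antidiagonalTuple, smul_eq_mul, mul_comm]
  have hn : 0 < n := i.pos
  refine Nat.eq_of_mul_eq_mul_left hn (htotal.trans ?_)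
  obtain ⟨k, rfl⟩ := Nat.exists_eq_succ_of_ne_zero hn.ne'
  cases m with
  | zero => simp
  | succ l =>
    have h := Nat.choose_succ_right_eq (k + l + 1) k
    rw [show k + l + 1 - k = l + 1 by omega] at h
    rw [show k.succ + (l + 1) - 1 = k + l + 1 by omega,
      Nat.choose_symm_of_eq_add (show k + l + 1 = (l + 1) + k by omega), Nat.succ_eq_add_one,
      mul_comm (k + 1), h, mul_comm]

section Determinant

variable {R : Type*} [CommRing R] {n m : ℕ}

theorem diagonal (d : Fin n → R) :
    symPowMatrix m (Matrix.diagonal d) = Matrix.diagonal fun μ => ∏ j, d j ^ μ.1 j := by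
  classical
  ext lam μ
  have hmon : (∏ j, (∑ l, C (Matrix.diagonal d j l) * X l : MvPolynomial (Fin n) R) ^ μ.1 j) =
      monomial (Finsupp.equivFunOnFinite.symm μ.1) (∏ j, d j ^ μ.1 j) := by
    rw [monomial_eq, Finsupp.prod_fintype _ _ (by simp)]
    simp [Matrix.diagonal_apply, apply_ite C, ite_mul, mul_pow, Finset.prod_mul_distrib]
  rw [apply, hmon, coeff_monomial, Matrix.diagonal_apply]
  simp only [EmbeddingLike.apply_eq_iff_eq, Subtype.coe_inj, eq_comm (a := μ)]
  split_ifs with h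
  · rw [h]
  · rfl

theorem det_diagonal (d : Fin n → R) :
    (symPowMatrix m (Matrix.diagonal d)).det =
      (Matrix.diagonal d).det ^ (n + m - 1).choose n := by
  rw [diagonal, Matrix.det_diagonal, Matrix.det_diagonal, Finset.prod_comm, ← Finset.prod_pow]
  refine Finset.prod_congr rfl fun i _ => ?_
  rw [Finset.prod_pow_eq_pow_sum, ← sum_antidiagonalTuple_apply m i]
  exact congrArg _ (Finset.sum_coe_sort (Finset.Nat.antidiagonalTuple n m) fun μ => μ i)

theorem transvection_apply {i j : Fin n} (hij : i ≠ j) (c : R)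
    (lam μ : {x : Fin n → ℕ // x ∈ Finset.Nat.antidiagonalTuple n m}) (h : μ.1 i ≤ lam.1 i) :
    symPowMatrix m (Matrix.transvection i j c) lam μ = (1 : Matrix _ _ R) lam μ := by
  classical
  have hrow (k : Fin n) :
      (∑ l, C (Matrix.transvection i j c k l) * X l : MvPolynomial (Fin n) R) =
        X k + if k = i then C c * X j else 0 := by
    simp only [Matrix.transvection, Matrix.add_apply, Matrix.one_apply, Matrix.single_apply,
      map_add, add_mul, Finset.sum_add_distrib, apply_ite C, map_one, map_zero, ite_mul, one_mul,
      zero_mul, Finset.sum_ite_eq, Finset.mem_univ, if_true, ite_and]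
    by_cases hk : k = i
    · simp [hk]
    · simp [hk, Ne.symm hk]
  have hprod : (∏ k, (∑ l, C (Matrix.transvection i j c k l) * X l :
      MvPolynomial (Fin n) R) ^ μ.1 k) =
      ∑ t ∈ range (μ.1 i + 1), monomial
        (((Finsupp.equivFunOnFinite.symm μ.1).erase i) + Finsupp.single i t +
          Finsupp.single j (μ.1 i - t)) (c ^ (μ.1 i - t) * (μ.1 i).choose t) := by
    have herase : monomial ((Finsupp.equivFunOnFinite.symm μ.1).erase i) (1 : R) =
        ∏ k ∈ univ.erase i, X k ^ μ.1 k := by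
      rw [monomial_eq, Finsupp.prod_fintype _ _ (by simp), ← Finset.mul_prod_erase _ _ (mem_univ i)]
      simp only [map_one, one_mul, Finsupp.erase_same, pow_zero]
      refine Finset.prod_congr rfl fun k hk => ?_
      rw [Finsupp.erase_ne (Finset.ne_of_mem_erase hk)]
      rfl
    rw [← Finset.mul_prod_erase _ _ (mem_univ i), hrow, if_pos rfl, add_pow, Finset.sum_mul]
    have hrest : (∏ k ∈ univ.erase i, (∑ l, C (Matrix.transvection i j c k l) * X l :
        MvPolynomial (Fin n) R) ^ μ.1 k) = ∏ k ∈ univ.erase i, X k ^ μ.1 k :=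
      Finset.prod_congr rfl fun k hk => by
        rw [hrow, if_neg (Finset.ne_of_mem_erase hk), add_zero]
    rw [hrest, ← herase]
    refine Finset.sum_congr rfl fun t _ => ?_
    rw [mul_pow, ← map_pow, X_pow_eq_monomial, X_pow_eq_monomial, ← map_natCast C]
    simp only [C_apply, monomial_mul]
    exact congrArg₂ (fun d r => monomial d r) (by abel) (by ring)
  rw [apply, hprod, coeff_sum, Finset.sum_eq_single (μ.1 i)]
  · have he : (Finsupp.equivFunOnFinite.symm μ.1).erase i + Finsupp.single i (μ.1 i) +
        Finsupp.single j (μ.1 i - μ.1 i) = Finsupp.equivFunOnFinite.symm μ.1 := by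
      simpa using Finsupp.erase_add_single i (Finsupp.equivFunOnFinite.symm μ.1)
    rw [he, coeff_monomial, Matrix.one_apply]
    simp [eq_comm (a := μ)]
  · intro t ht hti
    rw [coeff_monomial, if_neg]
    intro he
    have := DFunLike.congr_fun he i
    simp [hij] at this ht
    omega
  · simp

theorem det_transvection {i j : Fin n} (hij : i ≠ j) (c : R) :
    (symPowMatrix m (Matrix.transvection i j c)).det = 1 := by
  classical
  have htri : (symPowMatrix m (Matrix.transvection i j c)).BlockTriangular fun μ => μ.1 i := by
    intro lam μ h
    rw [transvection_apply hij c lam μ h.le, Matrix.one_apply_ne]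
    rintro rfl
    exact h.false
  rw [htri.det]
  refine Finset.prod_eq_one fun a _ => ?_
  rw [← Matrix.det_one (n := {μ : {x // x ∈ Finset.Nat.antidiagonalTuple n m} // μ.1 i = a})]
  congr 1
  ext lam μ
  rw [Matrix.toSquareBlock_def, Matrix.of_apply,
    transvection_apply hij c _ _ (μ.2.trans lam.2.symm).le]
  simp [Matrix.one_apply, Subtype.coe_inj]

end Determinant

end symPowMatrix

/-- Determinant of the `m`-th symmetric power: if `C` is the matrix, indexed by the
multi-indices of total degree `m`, whose `(λ,μ)` entry is the coefficient of `X^λ` in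
`∏_j (Σ_l A_{j,l} X_l)^{μ_j}`, then `det C = (det A)^{binom(n+m-1, n)}`. -/
theorem det_symmetric_power {K : Type*} [Field K] (n : ℕ) (hn : 1 ≤ n)
    (A : Matrix (Fin n) (Fin n) K) (m : ℕ) :
    Matrix.det
      (Matrix.of fun lam μ : {x : Fin n → ℕ // x ∈ Finset.Nat.antidiagonalTuple n m} =>
        MvPolynomial.coeff (Finsupp.equivFunOnFinite.symm lam.1)
          (∏ j : Fin n,
            (∑ l : Fin n, MvPolynomial.C (A j l) * MvPolynomial.X l) ^ (μ.1 j))) =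
      Matrix.det A ^ Nat.choose (n + m - 1) n := by
  change (symPowMatrix m A).det = _
  refine Matrix.diagonal_transvection_induction
    (fun A => (symPowMatrix m A).det = A.det ^ (n + m - 1).choose n) A
    (fun d _ => symPowMatrix.det_diagonal d) (fun t => ?_) (fun A B hA hB => ?_)
  · rw [Matrix.TransvectionStruct.toMatrix, symPowMatrix.det_transvection t.hij,
      Matrix.det_transvection_of_ne _ _ t.hij, one_pow]
  · rw [symPowMatrix.mul, Matrix.det_mul, Matrix.det_mul, hA, hB, mul_pow, mul_comm]
end

section
/- Let A be a commutative ring, n ≥ 1, and f₁,…,fₙ ∈ A[x₁,…,xₙ] such that the determinant of the Jacobian matrix J(f,x) := (∂fᵢ/∂xⱼ)_{1≤i,j≤n} is a unit of A[x₁,…,xₙ]. Then A[x₁,…,xₙ] is an étale algebra over its A-subalgebra R := A[f₁,…,fₙ] (the A-subalgebra of A[x₁,…,xₙ] generated by f₁,…,fₙ), i.e. the inclusion R ↪ A[x₁,…,xₙ] is an étale ring extension. -/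
open MvPolynomial in
/-- If the Jacobian determinant of `v` is a unit, then `R[xᵢ] ⧸ (v)` is étale over `R`. -/
theorem etale_quotient_span_range_of_isUnit_det_pderiv {R ι : Type*} [CommRing R] [Fintype ι]
    [DecidableEq ι] (v : ι → MvPolynomial ι R)
    (hv : IsUnit (Matrix.of fun i j => pderiv j (v i)).det) :
    Algebra.Etale R (MvPolynomial ι R ⧸ Ideal.span (Set.range v)) := by
  let P := Algebra.PreSubmersivePresentation.naive (v := v) id Function.injective_id
  have hP : P.jacobiMatrix = (Matrix.of fun i j => pderiv j (v i)).transpose := by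
    ext1 i j
    exact Algebra.PreSubmersivePresentation.jacobiMatrix_naive ..
  have hunit : IsUnit P.jacobian := by
    rw [P.jacobian_eq_jacobiMatrix_det, hP, Matrix.det_transpose]
    exact hv.map _
  let Q : Algebra.SubmersivePresentation R _ ι ι := ⟨P, hunit⟩
  exact Algebra.Etale.iff_isStandardSmoothOfRelativeDimension_zero.mpr
    (Q.isStandardSmoothOfRelativeDimension (by simp [Algebra.Presentation.dimension]))

open MvPolynomial in
/-- If `R` is generated as an `A`-algebra by elements `cᵢ` mapping to `fᵢ` in the `R`-algebra `A[x]`,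
then `A[x]` is presented over `R` as `R[X] ⧸ (f(X) - c)`. -/
noncomputable def quotientSpanMapSubCEquiv {A R ι κ : Type*} [CommRing A] [CommRing R]
    [Algebra A R] [Algebra R (MvPolynomial ι A)] [IsScalarTower A R (MvPolynomial ι A)]
    (f : κ → MvPolynomial ι A) (c : κ → R) (hc : Algebra.adjoin A (Set.range c) = ⊤)
    (hf : ∀ i, algebraMap R (MvPolynomial ι A) (c i) = f i) :
    (MvPolynomial ι R ⧸ Ideal.span (Set.range fun i => map (algebraMap A R) (f i) - C (c i))) ≃ₐ[R]
      MvPolynomial ι A := by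
  set I : Ideal (MvPolynomial ι R) :=
    Ideal.span (Set.range fun i => map (algebraMap A R) (f i) - C (c i))
  let g : MvPolynomial ι A →ₐ[A] MvPolynomial ι R ⧸ I :=
    aeval fun i => Ideal.Quotient.mk I (X i)
  have hg (p : MvPolynomial ι A) : g p = Ideal.Quotient.mk I (map (algebraMap A R) p) := by
    have : g = (Ideal.Quotient.mkₐ A I).comp (mapAlgHom (Algebra.ofId A R)) := by
      ext i
      simp [g]
    rw [this]
    rfl
  have hgR : g.comp (IsScalarTower.toAlgHom A R (MvPolynomial ι A)) =
      IsScalarTower.toAlgHom A R (MvPolynomial ι R ⧸ I) := by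
    refine AlgHom.ext_of_adjoin_eq_top hc ?_
    rintro _ ⟨i, rfl⟩
    change g (algebraMap R _ (c i)) = Ideal.Quotient.mk I (C (c i))
    rw [hf, hg, Ideal.Quotient.mk_eq_mk_iff_sub_mem]
    exact Ideal.subset_span ⟨i, rfl⟩
  let gR : MvPolynomial ι A →ₐ[R] MvPolynomial ι R ⧸ I :=
    { g with commutes' := fun r => DFunLike.congr_fun hgR r }
  have hI : I ≤ RingHom.ker (aeval X : MvPolynomial ι R →ₐ[R] MvPolynomial ι A) := by
    refine Ideal.span_le.mpr ?_
    rintro _ ⟨i, rfl⟩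
    simp [hf, aeval_map_algebraMap R X (f i)]
  let h : MvPolynomial ι R ⧸ I →ₐ[R] MvPolynomial ι A :=
    Ideal.Quotient.liftₐ I (aeval X) fun p hp => hI hp
  have hX (i : ι) : h (Ideal.Quotient.mk I (X i)) = X i := by
    change aeval X (X i) = _
    exact aeval_X _ _
  have hgX (i : ι) : gR (X i) = Ideal.Quotient.mk I (X i) := aeval_X _ _
  refine AlgEquiv.ofAlgHom h gR ?_ ?_
  · have : (h.comp gR).restrictScalars A = AlgHom.id A _ := by
      ext1 i
      change h (gR (X i)) = X i
      rw [hgX, hX]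
    exact AlgHom.ext fun p => DFunLike.congr_fun this p
  · refine Ideal.Quotient.algHom_ext _ (MvPolynomial.algHom_ext fun i => ?_)
    change gR (h (Ideal.Quotient.mk I (X i))) = Ideal.Quotient.mk I (X i)
    rw [hX, hgX]

open MvPolynomial in
/-- If `R` is generated as an `A`-algebra by elements mapping to `fᵢ` in the `R`-algebra `A[x]`
and the Jacobian determinant of `f` is a unit, then `A[x]` is étale over `R`. -/
theorem etale_of_adjoin_eq_top_of_isUnit_det_pderiv {A R ι : Type*} [CommRing A] [CommRing R]
    [Fintype ι] [DecidableEq ι] [Algebra A R] [Algebra R (MvPolynomial ι A)]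
    [IsScalarTower A R (MvPolynomial ι A)] (f : ι → MvPolynomial ι A) (c : ι → R)
    (hc : Algebra.adjoin A (Set.range c) = ⊤)
    (hf : ∀ i, algebraMap R (MvPolynomial ι A) (c i) = f i)
    (hdet : IsUnit (Matrix.of fun i j => pderiv j (f i)).det) :
    Algebra.Etale R (MvPolynomial ι A) := by
  have := etale_quotient_span_range_of_isUnit_det_pderiv
    (fun i => map (algebraMap A R) (f i) - C (c i)) (by
      convert hdet.map (map (algebraMap A R))
      rw [RingHom.map_det]
      congr 1
      ext1 i j
      simp [pderiv_map])
  exact .of_equiv (quotientSpanMapSubCEquiv f c hc hf)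

/-- If `f₁,…,fₙ ∈ A[x₁,…,xₙ]` have Jacobian determinant a unit of `A[x₁,…,xₙ]`, then
`A[x₁,…,xₙ]` is étale over its subalgebra `A[f₁,…,fₙ]`. -/
theorem etale_over_adjoin_of_jacobian_isUnit {A : Type*} [CommRing A] (n : ℕ) (hn : 1 ≤ n)
    (f : Fin n → MvPolynomial (Fin n) A)
    (hdet : IsUnit (Matrix.det
      (Matrix.of fun i j : Fin n => MvPolynomial.pderiv j (f i)))) :
    Algebra.Etale (Algebra.adjoin A (Set.range f)) (MvPolynomial (Fin n) A) := by
  refine etale_of_adjoin_eq_top_of_isUnit_det_pderiv f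
    (fun i => ⟨f i, Algebra.subset_adjoin ⟨i, rfl⟩⟩) ?_ (fun _ => rfl) hdet
  rw [← Algebra.adjoin_adjoin_coe_preimage]
  congr 1
  ext x
  simp [Subtype.ext_iff]
end
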